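/- arXiv:2208.08828 — 2 statements merged into one kernel-verified Lean document; each statement's English description precedes it below -/
import Mathlib

section
/- Let (R_k)_{k∈S} be a family of nonzero commutative rings with S infinite and R = ∏_{k∈S} R_k. Then the set of connected components of Spec(R) has cardinality at least 2^(2^|S|). If moreover each R_k has only finitely many idempotent elements, then the set of connected components of Spec(R) has cardinality exactly 2^(2^|S|). -/
universe u

/-- There is an independent family of `2 ^ |S|` subsets of an infinite set `S`: every pattern of
memberships prescribed on finitely many members of the family is realized by a point of `S`. -/
theorem exists_independent_family (S : Type*) [Infinite S] :
    ∃ X : Set S → Set S, ∀ (T : Finset (Set S)) (A : Set (Set S)),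
      ∃ k : S, ∀ B ∈ T, k ∈ X B ↔ B ∈ A := by
  classical
  obtain ⟨φ⟩ : Nonempty (S ≃ Finset S × Finset (Finset S)) := by
    rw [← Cardinal.eq, Cardinal.mk_prod, Cardinal.mk_finset_of_infinite (Finset S),
      Cardinal.mk_finset_of_infinite S, Cardinal.lift_id, Cardinal.mul_mk_eq_max, max_self]
  refine ⟨fun B ↦ {k | (φ k).1.filter (· ∈ B) ∈ (φ k).2}, fun T A ↦ ?_⟩
  have separate (B C : Set S) : ∃ x : S, B ≠ C → ¬(x ∈ B ↔ x ∈ C) := by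
    by_cases h : B = C
    · exact ⟨Classical.arbitrary S, fun h' ↦ absurd h h'⟩
    · have : ∃ x, ¬(x ∈ B ↔ x ∈ C) := by
        by_contra! h'
        exact h (Set.ext h')
      exact this.imp fun x hx _ ↦ hx
  choose d hd using separate
  let F : Finset S := (T ×ˢ T).image fun p ↦ d p.1 p.2
  let G : Finset (Finset S) := (T.filter (· ∈ A)).image fun B ↦ F.filter (· ∈ B)
  refine ⟨φ.symm (F, G), fun B hB ↦ ?_⟩
  simp only [Set.mem_ofPred_eq, Equiv.apply_symm_apply]
  refine ⟨fun h ↦ ?_, fun h ↦ Finset.mem_image_of_mem _ (Finset.mem_filter.2 ⟨hB, h⟩)⟩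
  obtain ⟨C, hC, hCB⟩ := Finset.mem_image.1 h
  obtain ⟨hCT, hCA⟩ := Finset.mem_filter.1 hC
  by_cases hne : B = C
  · exact hne ▸ hCA
  · have hF : d B C ∈ F := Finset.mem_image.2 ⟨(B, C), Finset.mk_mem_product hB hCT, rfl⟩
    have := Finset.ext_iff.1 hCB (d B C)
    simp only [Finset.mem_filter, hF, true_and] at this
    exact absurd this.symm (hd B C hne)

theorem IsClopen.mem_iff_of_connectedComponents_eq {α : Type*} [TopologicalSpace α] {s : Set α}
    (hs : IsClopen s) {x y : α} (h : (x : ConnectedComponents α) = y) : x ∈ s ↔ y ∈ s :=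
  ⟨fun hx ↦ hs.connectedComponent_subset hx (ConnectedComponents.coe_eq_coe'.1 h.symm),
    fun hy ↦ hs.connectedComponent_subset hy (ConnectedComponents.coe_eq_coe'.1 h)⟩

namespace PrimeSpectrum

section Idempotents

variable {A : Type*} [CommRing A]

/-- The ideal generated by the idempotents contained in a given ideal. -/
def idempotentIdeal (p : Ideal A) : Ideal A where
  carrier := {x | ∃ f ∈ p, IsIdempotentElem f ∧ f * x = x}
  zero_mem' := ⟨0, p.zero_mem, IsIdempotentElem.zero, mul_zero _⟩
  add_mem' := by
    rintro x y ⟨f, hfp, hf, hx⟩ ⟨g, hgp, hg, hy⟩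
    refine ⟨f + g - f * g, p.sub_mem (p.add_mem hfp hgp) (p.mul_mem_left _ hgp), ?_, ?_⟩
    · unfold IsIdempotentElem at *
      linear_combination (1 - 2 * g + g * g) * hf + (1 - f) * hg
    · linear_combination (1 - g) * hx + (1 - f) * hy
  smul_mem' := by
    rintro c x ⟨f, hfp, hf, hx⟩
    exact ⟨f, hfp, hf, by rw [smul_eq_mul]; linear_combination c * hx⟩

theorem mem_idempotentIdeal {p : Ideal A} {f : A} (hf : IsIdempotentElem f)
    (hfp : f ∈ p) : f ∈ idempotentIdeal p :=
  ⟨f, hfp, hf, hf⟩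

instance preconnectedSpace_quotient_idempotentIdeal (p : Ideal A) [p.IsPrime] :
    PreconnectedSpace (PrimeSpectrum (A ⧸ idempotentIdeal p)) := by
  rw [preconnectedSpace_iff_clopen]
  intro s hs
  obtain ⟨e, he, rfl⟩ := isClopen_iff.1 hs
  obtain ⟨x, rfl⟩ := Ideal.Quotient.mk_surjective e
  obtain ⟨f, hfp, hf, hfx⟩ : x * x - x ∈ idempotentIdeal p := by
    rwa [← Ideal.Quotient.eq, map_mul]
  have hg : IsIdempotentElem ((1 - f) * x) := by
    unfold IsIdempotentElem at *
    linear_combination (x * x) * hf - hfx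
  have hfI := mem_idempotentIdeal hf hfp
  have hmem : (1 - f) * x * (1 - (1 - f) * x) ∈ p := by
    rw [mul_sub, mul_one, hg.eq, sub_self]
    exact p.zero_mem
  rcases Ideal.IsPrime.mem_or_mem ‹_› hmem with h | h
  · left
    have hx : x ∈ idempotentIdeal p := by
      have := add_mem (mem_idempotentIdeal hg h)
        ((idempotentIdeal p).mul_mem_right x hfI)
      rwa [show (1 - f) * x + f * x = x by ring] at this
    rw [Ideal.Quotient.eq_zero_iff_mem.2 hx]
    simp
  · right
    have hx : 1 - x ∈ idempotentIdeal p := by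
      have := sub_mem (mem_idempotentIdeal hg.one_sub h)
        ((idempotentIdeal p).mul_mem_right x hfI)
      rwa [show 1 - (1 - f) * x - f * x = 1 - x by ring] at this
    rw [← Ideal.Quotient.eq.2 hx, map_one]
    simp

/-- Two primes containing the same idempotents lie in the same connected component. -/
theorem connectedComponents_eq_of_idempotents {p q : PrimeSpectrum A}
    (h : ∀ e : A, IsIdempotentElem e → e ∈ p.asIdeal → e ∈ q.asIdeal) :
    (q : ConnectedComponents (PrimeSpectrum A)) = p := by
  have hpre : IsPreconnected (zeroLocus (idempotentIdeal p.asIdeal : Set A)) := by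
    have := isPreconnected_range
      (continuous_comap (Ideal.Quotient.mk (idempotentIdeal p.asIdeal)))
    rwa [range_comap_of_surjective _ _ Ideal.Quotient.mk_surjective, Ideal.mk_ker] at this
  refine ConnectedComponents.coe_eq_coe'.2 (hpre.subset_connectedComponent ?_ ?_)
  · rintro x ⟨f, hfp, -, hx⟩
    exact hx ▸ p.asIdeal.mul_mem_right x hfp
  · rintro x ⟨f, hfp, hf, hx⟩
    exact hx ▸ q.asIdeal.mul_mem_right x (h f hf hfp)

theorem mk_connectedComponents_le (A : Type u) [CommRing A] :
    Cardinal.mk (ConnectedComponents (PrimeSpectrum A)) ≤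
      2 ^ Cardinal.mk {e : A // IsIdempotentElem e} := by
  rw [← Cardinal.mk_set]
  let rep : ConnectedComponents (PrimeSpectrum A) → PrimeSpectrum A :=
    Function.surjInv ConnectedComponents.surjective_coe
  have hrep (c : ConnectedComponents (PrimeSpectrum A)) : (rep c : ConnectedComponents _) = c :=
    Function.surjInv_eq ConnectedComponents.surjective_coe c
  refine Cardinal.mk_le_of_injective
    (f := fun c ↦ {e : {e : A // IsIdempotentElem e} | e.1 ∈ (rep c).asIdeal}) fun c d hcd ↦ ?_
  rw [← hrep c, ← hrep d]
  exact connectedComponents_eq_of_idempotents fun e he hed ↦ (Set.ext_iff.1 hcd ⟨e, he⟩).2 hed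

end Idempotents

section Pi

variable {S : Type u} (R : S → Type u) [∀ k, CommRing (R k)]

theorem two_power_two_power_le_mk_connectedComponents_pi [∀ k, Nontrivial (R k)] [Infinite S] :
    (2 : Cardinal.{u}) ^ ((2 : Cardinal.{u}) ^ Cardinal.mk S) ≤
      Cardinal.mk (ConnectedComponents (PrimeSpectrum (Π k, R k))) := by
  classical
  obtain ⟨X, hX⟩ := exists_independent_family S
  let ε (Y : Set S) : Π k, R k := fun k ↦ if k ∈ Y then 1 else 0
  have hε (Y : Set S) : IsIdempotentElem (ε Y) := by
    funext k
    by_cases hk : k ∈ Y <;> simp [ε, hk]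
  let U (B : Set S) : Set (PrimeSpectrum (Π k, R k)) := basicOpen (ε (X B))
  have hU (B : Set S) : IsClopen (U B) := isClopen_iff.2 ⟨_, hε _, rfl⟩
  let V (A : Set (Set S)) (B : Set S) : Set (PrimeSpectrum (Π k, R k)) :=
    if B ∈ A then U B else (U B)ᶜ
  have hV (A : Set (Set S)) (B : Set S) : IsClosed (V A B) := by
    by_cases hB : B ∈ A
    · simpa [V, hB] using (hU B).isClosed
    · simpa [V, hB] using (hU B).isOpen
  have mem_V (A : Set (Set S)) (B : Set S) (p) : p ∈ V A B ↔ (p ∈ U B ↔ B ∈ A) := by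
    by_cases hB : B ∈ A <;> simp [V, hB]
  have realize (A : Set (Set S)) : ∃ p, ∀ B, p ∈ U B ↔ B ∈ A := by
    obtain ⟨p, hp⟩ : (⋂ B, V A B).Nonempty := by
      refine CompactSpace.iInter_nonempty (hV A) fun T ↦ ?_
      obtain ⟨k, hk⟩ := hX T A
      let m : PrimeSpectrum (R k) := Classical.arbitrary _
      refine ⟨comap (Pi.evalRingHom R k) m, Set.mem_iInter₂.2 fun B hB ↦ ?_⟩
      rw [mem_V, ← hk B hB]
      by_cases hkB : k ∈ X B
      · simpa [U, ε, hkB] using m.asIdeal.ne_top_iff_one.1 m.2.ne_top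
      · simp [U, ε, hkB]
    exact ⟨p, fun B ↦ (mem_V A B p).1 (Set.mem_iInter.1 hp B)⟩
  choose P hP using realize
  rw [← Cardinal.mk_set, ← Cardinal.mk_set]
  refine Cardinal.mk_le_of_injective
    (f := fun A ↦ (P A : ConnectedComponents (PrimeSpectrum (Π k, R k)))) fun A A' h ↦ ?_
  ext B
  rw [← hP A B, ← hP A' B]
  exact (hU B).mem_iff_of_connectedComponents_eq h

theorem mk_idempotents_pi_le [Infinite S] (h : ∀ k, {e : R k | IsIdempotentElem e}.Finite) :
    Cardinal.mk {e : Π k, R k // IsIdempotentElem e} ≤ 2 ^ Cardinal.mk S := by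
  have hinj (k : S) : ∃ f : {e : R k | IsIdempotentElem e} → ULift.{u} ℕ, f.Injective := by
    have := (h k).countable.to_subtype
    obtain ⟨f, hf⟩ := exists_injective_nat {e : R k | IsIdempotentElem e}
    exact ⟨_, ULift.up_injective.comp hf⟩
  choose f hf using hinj
  have hS : Cardinal.aleph0 ≤ Cardinal.mk S := Cardinal.aleph0_le_mk S
  calc Cardinal.mk {e : Π k, R k // IsIdempotentElem e}
      ≤ Cardinal.mk (S → ULift.{u} ℕ) :=
        Cardinal.mk_le_of_injective
          (f := fun e k ↦ f k ⟨e.1 k, congrFun e.2 k⟩) fun e e' hee ↦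
            Subtype.ext <| funext fun k ↦ congrArg Subtype.val (hf k (congrFun hee k))
    _ = Cardinal.aleph0 ^ Cardinal.mk S := by simp
    _ = 2 ^ Cardinal.mk S :=
      Cardinal.power_eq_two_power hS (Cardinal.ofNat_lt_aleph0).le hS

end Pi

end PrimeSpectrum

/-- If `S` is infinite, then the set of connected components of `Spec(Π k, R k)` has
cardinality at least `2 ^ (2 ^ |S|)`; if moreover each `R k` has only finitely many
idempotents, then equality holds. -/
theorem card_connectedComponents_primeSpectrum_pi {S : Type u} (R : S → Type u)
    [∀ k, CommRing (R k)] [∀ k, Nontrivial (R k)] [Infinite S] :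
    (2 : Cardinal.{u}) ^ ((2 : Cardinal.{u}) ^ Cardinal.mk S) ≤
      Cardinal.mk (ConnectedComponents (PrimeSpectrum (Π k, R k))) ∧
    ((∀ k, {e : R k | IsIdempotentElem e}.Finite) →
      Cardinal.mk (ConnectedComponents (PrimeSpectrum (Π k, R k))) =
        (2 : Cardinal.{u}) ^ ((2 : Cardinal.{u}) ^ Cardinal.mk S)) := by
  have lower := PrimeSpectrum.two_power_two_power_le_mk_connectedComponents_pi R
  refine ⟨lower, fun h ↦ le_antisymm ?_ lower⟩
  exact (PrimeSpectrum.mk_connectedComponents_le _).trans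
    (Cardinal.power_le_power_left two_ne_zero (PrimeSpectrum.mk_idempotents_pi_le R h))
end

section
/- Let (R_k)_{k∈S} be a family of nonzero commutative rings and R = ∏_{k∈S} R_k. Then every connected component of Spec(R) is either entirely contained in the set of tame primes of R or entirely contained in the set of wild primes of R; that is, for every prime P of R, the connected component of P in Spec(R) consists only of tame primes or only of wild primes. -/
/-- A prime ideal of a direct product ring `Π i, R i` is *tame* if it is the preimage of a
prime ideal of one of the factors under the projection map. -/
def IsTamePrime {S : Type*} (R : S → Type*) [∀ i, CommRing (R i)]
    (P : Ideal (Π i, R i)) : Prop :=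
  ∃ (k : S) (p : Ideal (R k)), p.IsPrime ∧ P = p.comap (Pi.evalRingHom R k)

/-- A prime ideal of a direct product ring is *wild* if it is not tame. -/
def IsWildPrime {S : Type*} (R : S → Type*) [∀ i, CommRing (R i)]
    (P : Ideal (Π i, R i)) : Prop :=
  P.IsPrime ∧ ¬ IsTamePrime R P

open Classical in
/-- A prime of a product ring is tame iff it omits one of the coordinate idempotents. -/
theorem isTamePrime_iff_exists_single_notMem {S : Type*} (R : S → Type*) [∀ k, CommRing (R k)]
    (P : Ideal (Π k, R k)) [hP : P.IsPrime] :
    IsTamePrime R P ↔ ∃ k : S, (Pi.single k 1 : Π k, R k) ∉ P := by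
  constructor
  · rintro ⟨k, p, hp, rfl⟩
    refine ⟨k, fun h => hp.ne_top ((Ideal.eq_top_iff_one p).2 ?_)⟩
    simpa [Ideal.mem_comap] using h
  · rintro ⟨k, hk⟩
    have hsurj : Function.Surjective (Pi.evalRingHom R k) := Function.surjective_eval k
    have hker : RingHom.ker (Pi.evalRingHom R k) ≤ P := by
      intro x hx
      have hxk : x k = 0 := hx
      have hmul : x * Pi.single k 1 = 0 := by
        ext i
        by_cases hi : i = k
        · subst hi
          simp [hxk]
        · simp [Pi.single_eq_of_ne hi]
      exact (hP.mem_or_mem (hmul ▸ P.zero_mem)).resolve_right hk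
    refine ⟨k, P.map (Pi.evalRingHom R k), Ideal.map_isPrime_of_surjective hsurj hker, ?_⟩
    rw [Ideal.comap_map_of_surjective' _ hsurj, sup_eq_left.2 hker]


/-- Every connected component of `Spec(Π k, R k)` consists entirely of tame primes or
entirely of wild primes. -/
theorem connectedComponent_tame_or_wild {S : Type*} (R : S → Type*)
    [∀ k, CommRing (R k)] [∀ k, Nontrivial (R k)]
    (P : PrimeSpectrum (Π k, R k)) :
    (∀ Q ∈ connectedComponent P, IsTamePrime R Q.asIdeal) ∨
    (∀ Q ∈ connectedComponent P, IsWildPrime R Q.asIdeal) := by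
  classical
  have hmem {A B : PrimeSpectrum (Π k, R k)} (hA : IsTamePrime R A.asIdeal)
      (hB : B ∈ connectedComponent A) : IsTamePrime R B.asIdeal := by
    rw [isTamePrime_iff_exists_single_notMem] at hA ⊢
    obtain ⟨k, hk⟩ := hA
    have he : IsIdempotentElem (Pi.single k 1 : Π k, R k) := by
      rw [IsIdempotentElem, ← Pi.single_mul, one_mul]
    exact ⟨k, (PrimeSpectrum.isClopen_iff.2 ⟨_, he, rfl⟩).connectedComponent_subset
      hk hB⟩
  by_cases hP : IsTamePrime R P.asIdeal
  · exact Or.inl fun Q hQ => hmem hP hQ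
  · refine Or.inr fun Q hQ => ⟨Q.isPrime, fun hT => hP (hmem hT ?_)⟩
    rw [← connectedComponent_eq hQ]
    exact mem_connectedComponent
end
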